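/- Let p be a prime and f a polynomial with coefficients in ℤ_p. Set δ = 3 if p = 2 or p = 3, and δ = 2 if p ≥ 5. Then (ℤ_p, f) is minimal (every forward orbit {fᵏ(x) : k ≥ 0} is dense in ℤ_p) if and only if the induced map f_/δ on ℤ/p^δℤ is minimal (every forward orbit of f_/δ is all of ℤ/p^δℤ). -/

import Mathlib

open Polynomial

/-- The third-order Taylor expansion of a polynomial map at `x`. -/
lemma exists_eval_add_eq_taylor_three {R : Type*} [CommRing R] (f : Polynomial R) (x : R) :
    ∃ c : R, ∀ y : R, ∃ d : R,
      f.eval (x + y) = f.eval x + f.derivative.eval x * y + c * y ^ 2 + d * y ^ 3 := by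
  set g := taylor x f with hg
  refine ⟨g.coeff 2, fun y => ⟨g.divX.divX.divX.eval y, ?_⟩⟩
  have h : f.eval (x + y) = g.eval y := by rw [hg, taylor_eval, add_comm]
  have e (q : Polynomial R) : q.eval y = q.divX.eval y * y + q.coeff 0 := by
    conv_lhs => rw [← divX_mul_X_add q]
    simp
  have h0 : g.coeff 0 = f.eval x := taylor_coeff_zero x f
  have h1 : g.coeff 1 = f.derivative.eval x := taylor_coeff_one x f
  rw [h, e g, e g.divX, e g.divX.divX, ← h0, ← h1]
  simp only [coeff_divX]
  ring

lemma two_dvd_eval_derivative_derivative {R : Type*} [CommRing R] (f : Polynomial R) (x : R) :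
    2 ∣ f.derivative.derivative.eval x := by
  have h := congrFun (factorial_smul_hasseDeriv (R := R) 2) f
  refine ⟨(hasseDeriv 2 f).eval x, ?_⟩
  rw [show f.derivative.derivative = derivative^[2] f from rfl, ← h]
  simp [Nat.factorial]

/-- If `x` is fixed modulo `2` by `f` and `f' x` is odd, then `(f ∘ f)' x ≡ 1` modulo `4`. -/
lemma four_dvd_eval_derivative_comp_self_sub_one {R : Type*} [CommRing R] (f : Polynomial R)
    (x : R) (hx : 2 ∣ f.eval x - x) (hd : 2 ∣ f.derivative.eval x - 1) :
    4 ∣ (f.comp f).derivative.eval x - 1 := by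
  obtain ⟨s, hs⟩ := hx
  obtain ⟨v, hv⟩ := hd
  obtain ⟨w, hw⟩ := two_dvd_eval_derivative_derivative f x
  obtain ⟨q, hq⟩ := binomExpansion f.derivative x (2 * s)
  have h1 : f.eval x = x + 2 * s := by linear_combination hs
  have h2 : f.derivative.eval x = 1 + 2 * v := by linear_combination hv
  rw [derivative_comp, eval_mul, eval_comp, h1, hq, h2, hw]
  exact ⟨v + v ^ 2 + (1 + 2 * v) * (w * s + q * s ^ 2), by ring⟩

lemma iterate_comp_X_eval {R : Type*} [CommSemiring R] (f : Polynomial R) (k : ℕ) (x : R) :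
    (f.comp^[k] X).eval x = (fun z => f.eval z)^[k] x := by
  rw [iterate_comp_eval, eval_X]

/-- Iterates of a polynomial map close to a translation by `r * P * b`, to second order in `P`. -/
lemma exists_iterate_eval_eq {R : Type*} [CommRing R] (f : Polynomial R) (P r x b u : R)
    (hb : f.eval x = x + P * r * b) (hu : f.derivative.eval x = 1 + P * u) :
    ∃ c : R, ∀ i : ℕ, ∃ s : R, (fun z => f.eval z)^[i] x = x + P * r * (i * b +
      P * (u * b * (∑ j ∈ Finset.range i, j : ℕ) +
        r * c * b ^ 2 * (∑ j ∈ Finset.range i, j ^ 2 : ℕ)) + P ^ 2 * s) := by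
  obtain ⟨c, hc⟩ := exists_eval_add_eq_taylor_three f x
  refine ⟨c, fun i => ?_⟩
  induction i with
  | zero => exact ⟨0, by simp⟩
  | succ i ih =>
    obtain ⟨s, hs⟩ := ih
    set E : R := u * b * (∑ j ∈ Finset.range i, j : ℕ) +
        r * c * b ^ 2 * (∑ j ∈ Finset.range i, j ^ 2 : ℕ) with hE
    obtain ⟨d, hd⟩ := hc (P * r * (i * b + P * E + P ^ 2 * s))
    refine ⟨s + u * (E + P * s) + r * c * (2 * (i * b) * (E + P * s) + P * (E + P * s) ^ 2) +
      d * r ^ 2 * (i * b + P * E + P ^ 2 * s) ^ 3, ?_⟩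
    rw [Function.iterate_succ_apply', hs]
    simp only [hd, hb, hu, Finset.sum_range_succ]
    push_cast at hE ⊢
    linear_combination P ^ 2 * r * hE

lemma Finset.sum_range_sq_mul_six (n : ℕ) :
    ((∑ j ∈ Finset.range n, j ^ 2 : ℕ) : ℤ) * 6 = n * ((n - 1) * (2 * n - 1)) := by
  induction n with
  | zero => simp
  | succ n ih =>
    rw [Finset.sum_range_succ]
    push_cast at ih ⊢
    linear_combination ih

lemma Nat.Prime.dvd_sum_range {p : ℕ} (hp : p.Prime) (h2 : p ≠ 2) :
    p ∣ ∑ j ∈ Finset.range p, j := by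
  have h : p ∣ (∑ j ∈ Finset.range p, j) * 2 := by
    rw [Finset.sum_range_id_mul_two]; exact dvd_mul_right _ _
  exact (hp.dvd_mul.1 h).resolve_right
    fun h => h2 ((Nat.prime_dvd_prime_iff_eq hp Nat.prime_two).1 h)

lemma Nat.Prime.dvd_sum_range_sq {p : ℕ} (hp : p.Prime) (h2 : p ≠ 2) (h3 : p ≠ 3) :
    p ∣ ∑ j ∈ Finset.range p, j ^ 2 := by
  have h : p ∣ (∑ j ∈ Finset.range p, j ^ 2) * (2 * 3) := by
    zify
    have := Finset.sum_range_sq_mul_six p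
    push_cast at this
    norm_num
    rw [this]
    exact dvd_mul_right _ _
  refine (hp.dvd_mul.1 h).resolve_right fun h => ?_
  rcases hp.dvd_mul.1 h with h | h
  · exact h2 ((Nat.prime_dvd_prime_iff_eq hp Nat.prime_two).1 h)
  · exact h3 ((Nat.prime_dvd_prime_iff_eq hp Nat.prime_three).1 h)

/-- If some iterate of `g` connects any two points of a finite type, every point has
minimal period equal to the cardinality; and conversely. -/
lemma forall_exists_iterate_eq_iff_minimalPeriod {α : Type*} [Fintype α] (g : α → α) :
    (∀ x y, ∃ k : ℕ, g^[k] x = y) ↔ ∀ x, Function.minimalPeriod g x = Fintype.card α := by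
  constructor
  · intro h x
    have hx : 0 < Function.minimalPeriod g x := by
      obtain ⟨k, hk⟩ := h (g x) x
      exact Function.IsPeriodicPt.minimalPeriod_pos k.succ_pos hk
    let φ : Fin (Function.minimalPeriod g x) → α := fun i => g^[i] x
    have hφ : Function.Bijective φ := by
      refine ⟨fun i j hij => Fin.ext (Function.iterate_injOn_Iio_minimalPeriod i.2 j.2 hij),
        fun y => ?_⟩
      obtain ⟨k, hk⟩ := h x y
      exact ⟨⟨k % _, Nat.mod_lt _ hx⟩, by simp [φ, Function.iterate_mod_minimalPeriod_eq, hk]⟩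
    simpa using Fintype.card_of_bijective hφ
  · intro h x y
    let φ : Fin (Function.minimalPeriod g x) → α := fun i => g^[i] x
    have hφ : Function.Bijective φ := by
      rw [Fintype.bijective_iff_injective_and_card]
      exact ⟨fun i j hij => Fin.ext (Function.iterate_injOn_Iio_minimalPeriod i.2 j.2 hij),
        by simp [h]⟩
    obtain ⟨i, hi⟩ := hφ.2 y
    exact ⟨i, hi⟩

namespace PadicInt

variable {p : ℕ} [Fact p.Prime]

lemma toZModPow_eq_iff (n : ℕ) (x y : ℤ_[p]) :
    toZModPow n x = toZModPow n y ↔ (p : ℤ_[p]) ^ n ∣ x - y := by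
  rw [← sub_eq_zero, ← map_sub, ← RingHom.mem_ker, ker_toZModPow, Ideal.mem_span_singleton]

/-- The polynomial map `f` acts transitively modulo `p ^ n`. -/
def IsMinimalMod (f : Polynomial ℤ_[p]) (n : ℕ) : Prop :=
  ∀ x y : ℤ_[p], ∃ k : ℕ, (p : ℤ_[p]) ^ n ∣ (fun z => f.eval z)^[k] x - y

lemma toZModPow_iterate_eval (f : Polynomial ℤ_[p]) (n k : ℕ) (x : ℤ_[p]) :
    toZModPow n ((fun z => f.eval z)^[k] x) =
      (fun z => (f.map (toZModPow n)).eval z)^[k] (toZModPow n x) :=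
  Function.Semiconj.iterate_right (f := toZModPow n)
    (fun z => (eval_map_apply (toZModPow n) z).symm) k x

lemma isMinimalMod_iff_zmod (f : Polynomial ℤ_[p]) (n : ℕ) :
    IsMinimalMod f n ↔ ∀ x y : ZMod (p ^ n), ∃ k : ℕ,
      (fun z => (f.map (toZModPow n)).eval z)^[k] x = y := by
  have hs := ZMod.ringHom_surjective (toZModPow (p := p) n)
  simp only [IsMinimalMod, hs.forall, ← toZModPow_iterate_eval, toZModPow_eq_iff]

lemma forall_dense_iff_forall_isMinimalMod (f : Polynomial ℤ_[p]) :
    (∀ x : ℤ_[p], Dense (Set.range fun k : ℕ => (fun z : ℤ_[p] => f.eval z)^[k] x)) ↔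
      ∀ n, IsMinimalMod f n := by
  have hp : (0 : ℝ) < p := by exact_mod_cast (Fact.out : p.Prime).pos
  have key (n : ℕ) (z : ℤ_[p]) : ‖z‖ ≤ (p : ℝ) ^ (-(n : ℤ)) ↔ (p : ℤ_[p]) ^ n ∣ z := by
    rw [norm_le_pow_iff_mem_span_pow, Ideal.mem_span_singleton]
  simp only [Metric.dense_iff]
  constructor
  · intro h n x y
    obtain ⟨_, hz, k, rfl⟩ := h x y ((p : ℝ) ^ (-(n : ℤ))) (by positivity)
    rw [Metric.mem_ball, dist_eq_norm] at hz
    exact ⟨k, (key _ _).1 hz.le⟩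
  · intro h x y r hr
    obtain ⟨n, hn⟩ := exists_pow_neg_lt p hr
    obtain ⟨k, hk⟩ := h n x y
    refine ⟨_, ?_, k, rfl⟩
    rw [Metric.mem_ball, dist_eq_norm]
    exact ((key _ _).2 hk).trans_lt hn

lemma IsMinimalMod.mono {f : Polynomial ℤ_[p]} {m n : ℕ} (h : IsMinimalMod f n) (hmn : m ≤ n) :
    IsMinimalMod f m := fun x y =>
  (h x y).imp fun _ hk => (pow_dvd_pow _ hmn).trans hk

lemma isMinimalMod_iff_minimalPeriod (f : Polynomial ℤ_[p]) (n : ℕ) :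
    IsMinimalMod f n ↔ ∀ x : ZMod (p ^ n),
      Function.minimalPeriod (fun z => (f.map (toZModPow n)).eval z) x = p ^ n := by
  have : NeZero (p ^ n) := ⟨pow_ne_zero _ (Fact.out : p.Prime).ne_zero⟩
  rw [isMinimalMod_iff_zmod, forall_exists_iterate_eq_iff_minimalPeriod, ZMod.card]

lemma isPeriodicPt_toZModPow_iff (f : Polynomial ℤ_[p]) (n k : ℕ) (x : ℤ_[p]) :
    Function.IsPeriodicPt (fun z => (f.map (toZModPow n)).eval z) k (toZModPow n x) ↔
      (p : ℤ_[p]) ^ n ∣ (fun z => f.eval z)^[k] x - x := by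
  rw [← toZModPow_eq_iff, toZModPow_iterate_eval]
  rfl

lemma IsMinimalMod.dvd_iterate_sub_iff {f : Polynomial ℤ_[p]} {n : ℕ} (h : IsMinimalMod f n)
    (k : ℕ) (x : ℤ_[p]) : (p : ℤ_[p]) ^ n ∣ (fun z => f.eval z)^[k] x - x ↔ p ^ n ∣ k := by
  rw [← isPeriodicPt_toZModPow_iff, Function.isPeriodicPt_iff_minimalPeriod_dvd,
    (isMinimalMod_iff_minimalPeriod f n).1 h]

lemma IsMinimalMod.exists_iterate_eq {f : Polynomial ℤ_[p]} {n : ℕ}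
    (h : IsMinimalMod f (n + 1)) (x : ℤ_[p]) : ∃ b : ℤ_[p], ¬ (p : ℤ_[p]) ∣ b ∧
      (fun z => f.eval z)^[p ^ n] x = x + (p : ℤ_[p]) ^ n * b := by
  obtain ⟨b, hb⟩ := ((h.mono n.le_succ).dvd_iterate_sub_iff _ x).2 dvd_rfl
  refine ⟨b, ?_, by linear_combination hb⟩
  rintro ⟨c, rfl⟩
  have h1 := (h.dvd_iterate_sub_iff (p ^ n) x).1 ⟨c, by rw [hb]; ring⟩
  have := (Nat.pow_dvd_pow_iff_le_right (Fact.out : p.Prime).one_lt).1 h1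
  lia

/-- If `f` displaces every point by exactly `p ^ n`, then `f' ≡ 1` modulo `p`. -/
lemma dvd_eval_derivative_sub_one {f : Polynomial ℤ_[p]} {n : ℕ} (hn : n ≠ 0)
    (h : ∀ x, ∃ b : ℤ_[p], ¬ (p : ℤ_[p]) ∣ b ∧ f.eval x = x + (p : ℤ_[p]) ^ n * b)
    (x : ℤ_[p]) : (p : ℤ_[p]) ∣ f.derivative.eval x - 1 := by
  by_contra hd
  have hu : IsUnit (f.derivative.eval x - 1) := by
    rw [isUnit_iff]
    exact (norm_le_one _).eq_of_not_lt fun h => hd ((norm_lt_one_iff_dvd _).1 h)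
  obtain ⟨v, hv⟩ := hu.exists_right_inv
  obtain ⟨b, -, hb⟩ := h x
  obtain ⟨b', hb', hb''⟩ := h (x + (p : ℤ_[p]) ^ n * (-b * v))
  obtain ⟨q, hq⟩ := binomExpansion f x ((p : ℤ_[p]) ^ n * (-b * v))
  rw [hq, hb] at hb''
  have h0 : (p : ℤ_[p]) ^ n ≠ 0 := pow_ne_zero _ prime_p.ne_zero
  have h1 : b' = (p : ℤ_[p]) ^ n * (q * (b * v) ^ 2) := by
    apply mul_left_cancel₀ h0
    linear_combination -hb'' - (p : ℤ_[p]) ^ n * b * hv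
  exact hb' (h1 ▸ (dvd_pow_self _ hn).mul_right _)

lemma IsMinimalMod.succ_of_iterate {f : Polynomial ℤ_[p]} {n : ℕ} (hn : n ≠ 0)
    (h : ∀ x, ∃ b : ℤ_[p], ¬ (p : ℤ_[p]) ∣ b ∧
      (fun z => f.eval z)^[p ^ n] x = x + (p : ℤ_[p]) ^ n * b) : IsMinimalMod f (n + 1) := by
  rw [isMinimalMod_iff_minimalPeriod]
  have hs := ZMod.ringHom_surjective (toZModPow (p := p) (n + 1))
  refine hs.forall.2 fun x => Function.minimalPeriod_eq_prime_pow ?_ ?_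
  · rw [isPeriodicPt_toZModPow_iff]
    rintro ⟨c, hc⟩
    obtain ⟨b, hb, hb'⟩ := h x
    refine hb ⟨c, mul_left_cancel₀ (pow_ne_zero n (prime_p (p := p)).ne_zero) ?_⟩
    linear_combination hc - hb'
  · rw [isPeriodicPt_toZModPow_iff]
    set g : Polynomial ℤ_[p] := f.comp^[p ^ n] X
    have hg' : ∀ y, g.eval y = (fun z => f.eval z)^[p ^ n] y := iterate_comp_X_eval f _
    have hg'' : (fun z => g.eval z) = (fun z => f.eval z)^[p ^ n] := funext hg'
    simp only [← hg'] at h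
    obtain ⟨u, hu⟩ := dvd_eval_derivative_sub_one hn h x
    obtain ⟨b, -, hb⟩ := h x
    obtain ⟨m, rfl⟩ := Nat.exists_eq_add_one_of_ne_zero hn
    obtain ⟨c, hc⟩ := exists_iterate_eval_eq g p ((p : ℤ_[p]) ^ m) x b u
      (by rw [hb]; ring) (by linear_combination hu)
    obtain ⟨s, hs⟩ := hc p
    rw [pow_succ p (m + 1), Function.iterate_mul, ← hg'', hs, add_sub_cancel_left]
    exact ⟨b + (u * b * (∑ j ∈ Finset.range p, j : ℕ) +
      (p : ℤ_[p]) ^ m * c * b ^ 2 * (∑ j ∈ Finset.range p, j ^ 2 : ℕ)) + p * s, by ring⟩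

/-- A polynomial realizing `f^[p ^ (m + 1)]`, together with the extra congruence for its
derivative that is available when `p = 2`. -/
lemma IsMinimalMod.exists_polynomial_iterate {f : Polynomial ℤ_[p]} {m : ℕ}
    (h : IsMinimalMod f (m + 1)) (hm : p = 2 → m ≠ 0) : ∃ g : Polynomial ℤ_[p],
      (fun z => g.eval z) = (fun z => f.eval z)^[p ^ (m + 1)] ∧
        (p = 2 → ∀ x, (p : ℤ_[p]) ^ 2 ∣ g.derivative.eval x - 1) := by
  by_cases hp : p = 2
  · subst hp
    set k : Polynomial ℤ_[2] := f.comp^[2 ^ m] X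
    have hk' : (fun z => k.eval z) = (fun z => f.eval z)^[2 ^ m] :=
      funext (iterate_comp_X_eval f _)
    have hd : ∀ x, ∃ b : ℤ_[2], ¬ ((2 : ℕ) : ℤ_[2]) ∣ b ∧
        k.eval x = x + ((2 : ℕ) : ℤ_[2]) ^ m * b := fun x => by
      rw [show k.eval x = (fun z => f.eval z)^[2 ^ m] x from congrFun hk' x]
      exact h.exists_iterate_eq x
    refine ⟨k.comp k, ?_, fun _ x => ?_⟩
    · rw [pow_succ, mul_two, Function.iterate_add, ← hk']
      ext1 z
      exact eval_comp
    · have h1 := dvd_eval_derivative_sub_one (hm rfl) hd x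
      obtain ⟨b, -, hb⟩ := hd x
      have h2 : (2 : ℤ_[2]) ∣ k.eval x - x := by
        rw [hb, add_sub_cancel_left]
        exact (dvd_pow_self (2 : ℤ_[2]) (hm rfl)).mul_right _
      have := four_dvd_eval_derivative_comp_self_sub_one k x h2 (by exact_mod_cast h1)
      norm_num
      exact this
  · exact ⟨f.comp^[p ^ (m + 1)] X, funext (iterate_comp_X_eval f _), fun h => (hp h).elim⟩

lemma IsMinimalMod.succ {f : Polynomial ℤ_[p]} {n : ℕ} (h : IsMinimalMod f n)
    (hn : (if p = 2 ∨ p = 3 then 3 else 2) ≤ n) : IsMinimalMod f (n + 1) := by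
  have hp : p.Prime := Fact.out
  obtain ⟨m, rfl⟩ : ∃ m, n = m + 2 := Nat.exists_eq_add_of_le' (by split_ifs at hn <;> lia)
  have hm : p = 2 ∨ p = 3 → m ≠ 0 := fun h => by rw [if_pos h] at hn; lia
  obtain ⟨g, hg, hg2⟩ := (h.mono (Nat.le_succ _)).exists_polynomial_iterate
    fun h => hm (Or.inl h)
  have hgd : ∀ x, ∃ b : ℤ_[p], ¬ (p : ℤ_[p]) ∣ b ∧
      g.eval x = x + (p : ℤ_[p]) ^ (m + 1) * b := fun x => by
    rw [show g.eval x = (fun z => f.eval z)^[p ^ (m + 1)] x from congrFun hg x]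
    exact h.exists_iterate_eq x
  refine succ_of_iterate (by lia) fun x => ?_
  obtain ⟨b, hb, hgb⟩ := hgd x
  obtain ⟨u, hu⟩ := dvd_eval_derivative_sub_one m.succ_ne_zero hgd x
  obtain ⟨c, hc⟩ := exists_iterate_eval_eq g p ((p : ℤ_[p]) ^ m) x b u
    (by rw [hgb]; ring) (by linear_combination hu)
  obtain ⟨s, hs⟩ := hc p
  have h1 : (p : ℤ_[p]) ∣ u * (∑ j ∈ Finset.range p, j : ℕ) := by
    by_cases h2 : p = 2
    · obtain ⟨w, hw⟩ := hg2 h2 x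
      refine Dvd.dvd.mul_right ⟨w, mul_left_cancel₀ prime_p.ne_zero ?_⟩ _
      linear_combination hw - hu
    · exact (Nat.cast_dvd_cast (hp.dvd_sum_range h2)).mul_left _
  have h2 : (p : ℤ_[p]) ∣ (p : ℤ_[p]) ^ m * (∑ j ∈ Finset.range p, j ^ 2 : ℕ) := by
    by_cases h23 : p = 2 ∨ p = 3
    · exact (dvd_pow_self _ (hm h23)).mul_right _
    · push Not at h23
      exact (Nat.cast_dvd_cast (hp.dvd_sum_range_sq h23.1 h23.2)).mul_left _
  obtain ⟨v, hv⟩ := h1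
  obtain ⟨w, hw⟩ := h2
  refine ⟨b + p * (b * v + c * b ^ 2 * w + s), ?_, ?_⟩
  · rwa [← dvd_add_left (dvd_mul_right (p : ℤ_[p]) _)] at hb
  · rw [pow_succ p (m + 1), Function.iterate_mul, ← hg, hs]
    linear_combination (p : ℤ_[p]) ^ (m + 2) * (b * hv + c * b ^ 2 * hw)

end PadicInt

/-- Let `p` be a prime, `f` a polynomial over `ℤ_[p]`, and `δ = 3` if `p = 2` or `p = 3`,
`δ = 2` otherwise (i.e. `p ≥ 5`).  Then `(ℤ_p, f)` is minimal iff the induced map `f_/δ`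
on `ℤ/p^δℤ` is minimal. -/
theorem stmt_3 (p : ℕ) [Fact p.Prime] (f : Polynomial ℤ_[p]) :
    (∀ x : ℤ_[p], Dense (Set.range fun k : ℕ => (fun z : ℤ_[p] => f.eval z)^[k] x)) ↔
      (∀ x y : ZMod (p ^ (if p = 2 ∨ p = 3 then 3 else 2)),
        ∃ k : ℕ,
          (fun z : ZMod (p ^ (if p = 2 ∨ p = 3 then 3 else 2)) =>
            (f.map (PadicInt.toZModPow (if p = 2 ∨ p = 3 then 3 else 2))).eval z)^[k] x = y) := by
  rw [PadicInt.forall_dense_iff_forall_isMinimalMod, ← PadicInt.isMinimalMod_iff_zmod]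
  refine ⟨fun h => h _, fun h n => ?_⟩
  rcases le_total n (if p = 2 ∨ p = 3 then 3 else 2) with hn | hn
  · exact h.mono hn
  · exact Nat.le_induction h (fun _ hk ih => ih.succ hk) n hn
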